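/- Let λ_{1,max} = ‖Xᵀy/n‖_∞. If λ₁ < λ_{1,max}, then the Boosted Lasso solution β̂^{λ₁,λ₂} equals the Lasso solution β̂^{λ₁} if and only if λ₂ ≥ λ₁. Moreover, if λ₁ ≥ λ_{1,max}, then the Boosted Lasso estimator with parameters (λ₁, λ₂) is exactly the Lasso estimator with tuning parameter λ₂. -/

import Mathlib

open MeasureTheory ProbabilityTheory Finset

noncomputable section

/-- Product Gaussian measure `N(0, σ² I_n)` on `ℝⁿ`. -/
def gaussianVec (n : ℕ) (σ : ℝ) : Measure (Fin n → ℝ) :=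
  Measure.pi fun _ => gaussianReal 0 (σ ^ 2).toNNReal

/-- Squared Euclidean norm. -/
def l2sq {m : ℕ} (v : Fin m → ℝ) : ℝ := ∑ i, (v i) ^ 2

/-- Euclidean norm. -/
def l2 {m : ℕ} (v : Fin m → ℝ) : ℝ := Real.sqrt (l2sq v)

/-- ℓ₁ norm. -/
def l1 {m : ℕ} (v : Fin m → ℝ) : ℝ := ∑ i, |v i|

/-- Lasso objective `(1/2n)‖y − Xβ‖₂² + λ‖β‖₁`. -/
def lassoObj {n p : ℕ} (X : Matrix (Fin n) (Fin p) ℝ) (y : Fin n → ℝ) (lam : ℝ)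
    (β : Fin p → ℝ) : ℝ :=
  l2sq (y - X.mulVec β) / (2 * (n : ℝ)) + lam * l1 β

/-- `b` is a Lasso solution with tuning parameter `lam`. -/
def IsLassoSol {n p : ℕ} (X : Matrix (Fin n) (Fin p) ℝ) (y : Fin n → ℝ) (lam : ℝ)
    (b : Fin p → ℝ) : Prop :=
  ∀ β : Fin p → ℝ, lassoObj X y lam b ≤ lassoObj X y lam β

/-- Restricted eigenvalue condition RE(c₀, s) with constant `κ`:
for every `J` with `|J| ≤ s` and every `Δ` with `‖Δ_{Jᶜ}‖₁ ≤ c₀‖Δ_J‖₁`,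
one has `‖XΔ‖₂² ≥ κ² n ‖Δ_J‖₂²`. -/
def RE {n p : ℕ} (X : Matrix (Fin n) (Fin p) ℝ) (c0 : ℝ) (s : ℕ) (κ : ℝ) : Prop :=
  0 < κ ∧ ∀ J : Finset (Fin p), J.card ≤ s → ∀ Δ : Fin p → ℝ,
    (∑ j ∈ Jᶜ, |Δ j|) ≤ c0 * ∑ j ∈ J, |Δ j| →
    κ ^ 2 * ((n : ℝ) * ∑ j ∈ J, (Δ j) ^ 2) ≤ l2sq (X.mulVec Δ)

/-- The Lasso subgradient `ρ̂ = Xᵀ(y − Xβ̂)/(λ n)`. -/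
def lassoSubgrad {n p : ℕ} (X : Matrix (Fin n) (Fin p) ℝ) (y : Fin n → ℝ) (lam : ℝ)
    (b : Fin p → ℝ) : Fin p → ℝ :=
  fun j => (X.transpose.mulVec (y - X.mulVec b)) j / (lam * (n : ℝ))

/-- Boosted Lasso objective `(1/2n)‖y − Xβ‖₂² + λ₂‖β − β̂‖₁`. -/
def boostedObj {n p : ℕ} (X : Matrix (Fin n) (Fin p) ℝ) (y : Fin n → ℝ) (lam2 : ℝ)
    (bhat β : Fin p → ℝ) : ℝ :=
  l2sq (y - X.mulVec β) / (2 * (n : ℝ)) + lam2 * l1 (β - bhat)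

/-- `b` is a Boosted Lasso solution built upon the first-step estimator `bhat`. -/
def IsBoostedSol {n p : ℕ} (X : Matrix (Fin n) (Fin p) ℝ) (y : Fin n → ℝ) (lam2 : ℝ)
    (bhat b : Fin p → ℝ) : Prop :=
  ∀ β : Fin p → ℝ, boostedObj X y lam2 bhat b ≤ boostedObj X y lam2 bhat β

/-- Bregman Lasso objective
`(1/2n)‖y − Xβ‖₂² + λ₂(‖β‖₁ − ⟨ρ̂^{λ₁}, β⟩)` where `ρ̂^{λ₁}` is the
Lasso subgradient associated with `bhat`. -/
def bregmanObj {n p : ℕ} (X : Matrix (Fin n) (Fin p) ℝ) (y : Fin n → ℝ) (lam1 lam2 : ℝ)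
    (bhat β : Fin p → ℝ) : ℝ :=
  l2sq (y - X.mulVec β) / (2 * (n : ℝ)) +
    lam2 * (l1 β - ∑ j, lassoSubgrad X y lam1 bhat j * β j)

/-- `b` is a Bregman Lasso solution with parameters `(lam1, lam2)`. -/
def IsBregmanSol {n p : ℕ} (X : Matrix (Fin n) (Fin p) ℝ) (y : Fin n → ℝ) (lam1 lam2 : ℝ)
    (bhat b : Fin p → ℝ) : Prop :=
  ∀ β : Fin p → ℝ, bregmanObj X y lam1 lam2 bhat b ≤ bregmanObj X y lam1 lam2 bhat β

/-- `bbar` is a sign-consistent refitting of the Lasso solution `bhat`: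
it does not increase the residual norm and `(1/n)Xᵀ(y − Xβ̂) ∈ λ·sign(β̄)`
componentwise. -/
def SignConsistentRefit {n p : ℕ} (X : Matrix (Fin n) (Fin p) ℝ) (y : Fin n → ℝ) (lam : ℝ)
    (bhat bbar : Fin p → ℝ) : Prop :=
  l2 (y - X.mulVec bbar) ≤ l2 (y - X.mulVec bhat) ∧
  ∀ j, (0 < bbar j → X.transpose.mulVec (y - X.mulVec bhat) j / (n : ℝ) = lam) ∧
       (bbar j < 0 → X.transpose.mulVec (y - X.mulVec bhat) j / (n : ℝ) = -lam) ∧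
       (bbar j = 0 → |X.transpose.mulVec (y - X.mulVec bhat) j / (n : ℝ)| ≤ lam)

/-- `bbar` is a Sign-Least-Squares Lasso refitting of the Lasso solution `bhat`:
it vanishes outside the equicorrelation set `E = {j : |ρ̂_j| = 1}` and minimizes
the residual sum of squares among all vectors supported on `E` whose coordinates
have signs compatible with `ρ̂_E`. -/
def IsSLSSol {n p : ℕ} (X : Matrix (Fin n) (Fin p) ℝ) (y : Fin n → ℝ) (lam : ℝ)
    (bhat bbar : Fin p → ℝ) : Prop :=
  (∀ j, |lassoSubgrad X y lam bhat j| ≠ 1 → bbar j = 0) ∧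
  (∀ j, 0 ≤ lassoSubgrad X y lam bhat j * bbar j) ∧
  ∀ β : Fin p → ℝ,
    ((∀ j, |lassoSubgrad X y lam bhat j| ≠ 1 → β j = 0) ∧
     (∀ j, 0 ≤ lassoSubgrad X y lam bhat j * β j)) →
    l2sq (y - X.mulVec bbar) ≤ l2sq (y - X.mulVec β)

/-- Componentwise soft-thresholding operator `softThresh(y, λ)_j = sign(y_j)(|y_j| − λ)₊`. -/
def softThresh {p : ℕ} (y : Fin p → ℝ) (lam : ℝ) : Fin p → ℝ :=
  fun j => Real.sign (y j) * max (|y j| - lam) 0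

/-- Componentwise firm-thresholding (MCP) operator. -/
def MCP {p : ℕ} (y : Fin p → ℝ) (μ γ : ℝ) : Fin p → ℝ :=
  fun j => if |y j| ≤ μ * γ then γ / (γ - 1) * (Real.sign (y j) * max (|y j| - μ) 0) else y j

/-- Bregman objective in the denoising (orthogonal, `X = I_p`) case:
`(1/2)‖y − β‖₂² + λ(‖β‖₁ − ⟨ρ, β⟩)`. -/
def denoiseBregObj {p : ℕ} (y ρ : Fin p → ℝ) (lam : ℝ) (β : Fin p → ℝ) : ℝ :=
  (1 / 2) * l2sq (y - β) + lam * (l1 β - ∑ j, ρ j * β j)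

end

lemma l2sq_nonneg {m : ℕ} (v : Fin m → ℝ) : 0 ≤ l2sq v :=
  Finset.sum_nonneg fun _ _ => sq_nonneg _

lemma l1_nonneg {m : ℕ} (v : Fin m → ℝ) : 0 ≤ l1 v :=
  Finset.sum_nonneg fun _ _ => abs_nonneg _

lemma eq_zero_of_l2sq_nonpos {m : ℕ} {v : Fin m → ℝ} (h : l2sq v ≤ 0) : v = 0 := by
  have h0 := (Finset.sum_eq_zero_iff_of_nonneg fun i _ => sq_nonneg (v i)).1
    (le_antisymm h (l2sq_nonneg v))
  funext i
  exact pow_eq_zero_iff two_ne_zero |>.1 (h0 i (Finset.mem_univ i))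

lemma eq_zero_of_l1_nonpos {m : ℕ} {v : Fin m → ℝ} (h : l1 v ≤ 0) : v = 0 := by
  have h0 := (Finset.sum_eq_zero_iff_of_nonneg fun i _ => abs_nonneg (v i)).1
    (le_antisymm h (l1_nonneg v))
  funext i
  exact abs_eq_zero.1 (h0 i (Finset.mem_univ i))

lemma l1_smul {m : ℕ} {t : ℝ} (ht : 0 ≤ t) (v : Fin m → ℝ) : l1 (t • v) = t * l1 v := by
  simp [l1, abs_mul, abs_of_nonneg ht, Finset.mul_sum]

lemma l1_add_le {m : ℕ} (u v : Fin m → ℝ) : l1 (u + v) ≤ l1 u + l1 v := by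
  rw [l1, l1, l1, ← Finset.sum_add_distrib]
  exact Finset.sum_le_sum fun i _ => abs_add_le (u i) (v i)

lemma l2sq_sub_smul {m : ℕ} (u w : Fin m → ℝ) (t : ℝ) :
    l2sq (u - t • w) = l2sq u - 2 * t * (u ⬝ᵥ w) + t ^ 2 * l2sq w := by
  simp only [l2sq, dotProduct, Finset.mul_sum, ← Finset.sum_sub_distrib,
    ← Finset.sum_add_distrib, Pi.sub_apply, Pi.smul_apply, smul_eq_mul]
  exact Finset.sum_congr rfl fun i _ => by ring

lemma quadratic_loss_add_smul {n p : ℕ} (X : Matrix (Fin n) (Fin p) ℝ) (y : Fin n → ℝ)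
    (b v : Fin p → ℝ) (t : ℝ) :
    l2sq (y - X.mulVec (b + t • v)) / (2 * (n : ℝ)) =
      l2sq (y - X.mulVec b) / (2 * (n : ℝ)) - t * ((y - X.mulVec b) ⬝ᵥ X.mulVec v / n)
        + t ^ 2 * (l2sq (X.mulVec v) / (2 * n)) := by
  rw [Matrix.mulVec_add, Matrix.mulVec_smul, ← sub_sub, l2sq_sub_smul]
  ring

lemma nonpos_of_forall_mul_le_sq_mul {a c : ℝ}
    (h : ∀ t : ℝ, 0 < t → t ≤ 1 → t * a ≤ t ^ 2 * c) : a ≤ 0 := by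
  by_contra! ha
  have hc : 0 < c := by linarith [h 1 one_pos le_rfl]
  have hd : 0 < a + c := by positivity
  have ht : 0 < a / (a + c) := by positivity
  have h1 := h (a / (a + c)) ht ((div_le_one hd).2 (by linarith))
  have h2 : a ≤ a / (a + c) * c := by nlinarith
  rw [div_mul_eq_mul_div, le_div_iff₀ hd] at h2
  nlinarith

lemma dotProduct_mulVec_div_le {n p : ℕ} (X : Matrix (Fin n) (Fin p) ℝ) (y : Fin n → ℝ)
    {M : ℝ} (hM : ∀ j, |X.transpose.mulVec y j / (n : ℝ)| ≤ M) (v : Fin p → ℝ) :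
    y ⬝ᵥ X.mulVec v / n ≤ M * l1 v := by
  rw [Matrix.dotProduct_mulVec, ← Matrix.mulVec_transpose, dotProduct, Finset.sum_div, l1,
    Finset.mul_sum]
  refine Finset.sum_le_sum fun j _ => ?_
  calc X.transpose.mulVec y j * v j / n = X.transpose.mulVec y j / n * v j := by ring
    _ ≤ |X.transpose.mulVec y j / n| * |v j| := by rw [← abs_mul]; exact le_abs_self _
    _ ≤ M * |v j| := mul_le_mul_of_nonneg_right (hM j) (abs_nonneg _)

lemma abs_transpose_mulVec_div_le {n p : ℕ} (X : Matrix (Fin n) (Fin p) ℝ) (y : Fin n → ℝ)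
    {M : ℝ} (hM : ∀ v : Fin p → ℝ, y ⬝ᵥ X.mulVec v / n ≤ M * l1 v) (j : Fin p) :
    |X.transpose.mulVec y j / (n : ℝ)| ≤ M := by
  have hs (s : ℝ) (hs : |s| = 1) : X.transpose.mulVec y j * s / n ≤ M := by
    have h := hM (Pi.single j s)
    have hl : l1 (Pi.single j s) = 1 := by
      rw [l1, Finset.sum_eq_single j] <;> simp +contextual [hs]
    rwa [Matrix.dotProduct_mulVec, ← Matrix.mulVec_transpose, dotProduct_single, hl,
      mul_one] at h
  have h1 := hs 1 (by simp)
  have h2 := hs (-1) (by simp)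
  rw [mul_one] at h1
  rw [mul_neg_one, neg_div] at h2
  exact abs_le.2 ⟨by linarith, h1⟩

lemma IsLassoSol.dotProduct_residual_le {n p : ℕ} {X : Matrix (Fin n) (Fin p) ℝ}
    {y : Fin n → ℝ} {lam : ℝ} (hlam : 0 ≤ lam) {b : Fin p → ℝ} (hb : IsLassoSol X y lam b)
    (v : Fin p → ℝ) : (y - X.mulVec b) ⬝ᵥ X.mulVec v / n ≤ lam * l1 v := by
  refine sub_nonpos.1 (nonpos_of_forall_mul_le_sq_mul
    (c := l2sq (X.mulVec v) / (2 * n)) fun t ht _ => ?_)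
  have h := hb (b + t • v)
  simp only [lassoObj, quadratic_loss_add_smul] at h
  have h1 := mul_le_mul_of_nonneg_left (l1_add_le b (t • v)) hlam
  rw [l1_smul ht.le] at h1
  linarith

lemma IsLassoSol.le_dotProduct_residual {n p : ℕ} {X : Matrix (Fin n) (Fin p) ℝ}
    {y : Fin n → ℝ} {lam : ℝ} {b : Fin p → ℝ} (hb : IsLassoSol X y lam b) :
    lam * l1 b ≤ (y - X.mulVec b) ⬝ᵥ X.mulVec b / n := by
  refine sub_nonpos.1 (nonpos_of_forall_mul_le_sq_mul
    (c := l2sq (X.mulVec b) / (2 * n)) fun t ht ht1 => ?_)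
  have h := hb (b + (-t) • b)
  have hs : l1 (b + (-t) • b) = (1 - t) * l1 b := by
    rw [← l1_smul (sub_nonneg.2 ht1)]
    congr 1
    module
  simp only [lassoObj, quadratic_loss_add_smul, hs] at h
  linarith

/-- The first-step estimator is a fixed point of boosting exactly when the gradient of the
quadratic loss there is bounded by `lam` in the norm dual to `l1`. -/
lemma isBoostedSol_self_iff {n p : ℕ} (X : Matrix (Fin n) (Fin p) ℝ) (y : Fin n → ℝ)
    (lam : ℝ) (b : Fin p → ℝ) :
    IsBoostedSol X y lam b b ↔
      ∀ v : Fin p → ℝ, (y - X.mulVec b) ⬝ᵥ X.mulVec v / n ≤ lam * l1 v := by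
  have h0 : l1 (b - b) = 0 := by simp [l1]
  constructor
  · intro h v
    refine sub_nonpos.1 (nonpos_of_forall_mul_le_sq_mul
      (c := l2sq (X.mulVec v) / (2 * n)) fun t ht _ => ?_)
    have h1 := h (b + t • v)
    simp only [boostedObj, quadratic_loss_add_smul, h0, add_sub_cancel_left, l1_smul ht.le] at h1
    linarith
  · intro h β
    have h1 := quadratic_loss_add_smul X y b (β - b) 1
    rw [one_smul, add_sub_cancel] at h1
    have h2 : 0 ≤ l2sq (X.mulVec (β - b)) / (2 * n) := div_nonneg (l2sq_nonneg _) (by positivity)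
    simp only [boostedObj, h0, h1]
    linarith [h (β - b)]

lemma IsLassoSol.eq_zero {n p : ℕ} (hn : 0 < n) {X : Matrix (Fin n) (Fin p) ℝ}
    {y : Fin n → ℝ} {lam : ℝ} (hlam : 0 < lam) {b : Fin p → ℝ} (hb : IsLassoSol X y lam b)
    (h : ∀ j, |X.transpose.mulVec y j / (n : ℝ)| ≤ lam) : b = 0 := by
  have hn' : (0 : ℝ) < n := by exact_mod_cast hn
  have h1 := hb.le_dotProduct_residual
  have h2 := dotProduct_mulVec_div_le X y h b
  have hsq : X.mulVec b ⬝ᵥ X.mulVec b = l2sq (X.mulVec b) := by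
    simp [l2sq, dotProduct, sq]
  have hX : X.mulVec b = 0 := by
    apply eq_zero_of_l2sq_nonpos
    rw [sub_dotProduct, hsq, sub_div] at h1
    have h3 : l2sq (X.mulVec b) / n ≤ 0 := by linarith
    simpa using (div_le_iff₀ hn').1 h3
  rw [hX, dotProduct_zero, zero_div] at h1
  exact eq_zero_of_l1_nonpos (nonpos_of_mul_nonpos_right h1 hlam)

theorem stmt5 (n p : ℕ) (hn : 0 < n) (hp : 0 < p)
    (X : Matrix (Fin n) (Fin p) ℝ) (y : Fin n → ℝ)
    (lam1 lam2 : ℝ) (hlam1 : 0 < lam1) (hlam2 : 0 < lam2)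
    (bhat : Fin p → ℝ) (hb : IsLassoSol X y lam1 bhat)
    (lam1max : ℝ) (hlam1max : lam1max = ⨆ j, |X.transpose.mulVec y j / (n : ℝ)|) :
    (lam1 < lam1max → (IsBoostedSol X y lam2 bhat bhat ↔ lam1 ≤ lam2)) ∧
    (lam1max ≤ lam1 →
      ∀ b : Fin p → ℝ, IsBoostedSol X y lam2 bhat b ↔ IsLassoSol X y lam2 b) := by
  have hbdd : BddAbove (Set.range fun j => |X.transpose.mulVec y j / (n : ℝ)|) :=
    (Set.finite_range _).bddAbove
  constructor
  · intro hlt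
    rw [isBoostedSol_self_iff]
    refine ⟨fun h => ?_, fun h v => (hb.dotProduct_residual_le hlam1.le v).trans
      (mul_le_mul_of_nonneg_right h (l1_nonneg v))⟩
    refine le_of_mul_le_mul_right (hb.le_dotProduct_residual.trans (h bhat)) ?_
    by_contra! hl
    have hbz := eq_zero_of_l1_nonpos hl
    have hg := hb.dotProduct_residual_le hlam1.le
    simp only [hbz, Matrix.mulVec_zero, sub_zero] at hg
    have : Nonempty (Fin p) := ⟨⟨0, hp⟩⟩
    exact hlt.not_ge (hlam1max ▸ ciSup_le (abs_transpose_mulVec_div_le X y hg))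
  · intro hle b
    have hbz : bhat = 0 := hb.eq_zero hn hlam1 fun j =>
      (le_ciSup hbdd j).trans (hlam1max ▸ hle)
    simp only [IsBoostedSol, IsLassoSol, boostedObj, lassoObj, hbz, sub_zero]
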